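/- arXiv:1808.10321 — 2 statements merged into one kernel-verified Lean document; each statement's English description precedes it below -/
import Mathlib

section
/- The vector w = ((17/13, -9/13^5, 4/13^7), (7/13^6, -6/13^7)) lies in the Niemeier lattice A_12², has norm 8, and is extremal; moreover exactly 5 roots u satisfy u·w = -2 and exactly 12 norm-4 vectors u satisfy u·w = -4, so that 1 + |S_2^w| + (1/2)|S_4^w| = 12 ≢ 0 (mod 8). -/
/-- The standard inner product on `ℚ^26`. -/
def qip (x y : Fin 26 → ℚ) : ℚ := ∑ i, x i * y i

/-- A rational vector with all coordinates integral. -/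
def isIntVec (x : Fin 26 → ℚ) : Prop := ∀ i, ∃ m : ℤ, x i = (m : ℚ)

/-- First copy of the root lattice `A_12` (coordinates `0,…,12`). -/
def A12a : Set (Fin 26 → ℚ) :=
  {x | isIntVec x ∧ (∑ i, x i) = 0 ∧ ∀ i : Fin 26, 13 ≤ i.val → x i = 0}

/-- Second copy of the root lattice `A_12` (coordinates `13,…,25`). -/
def A12b : Set (Fin 26 → ℚ) :=
  {x | isIntVec x ∧ (∑ i, x i) = 0 ∧ ∀ i : Fin 26, i.val < 13 → x i = 0}

/-- The glue vector `g = ((1/13^12, -12/13), (5/13^8, -8/13^5))`. -/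
def glueA12 : Fin 26 → ℚ := fun i =>
  if i.val < 12 then 1 / 13 else if i.val = 12 then -(12 / 13)
  else if i.val < 21 then 5 / 13 else -(8 / 13)

/-- The Niemeier lattice `A_12²`. -/
def NiemeierA12sq : AddSubgroup (Fin 26 → ℚ) :=
  AddSubgroup.closure (A12a ∪ A12b ∪ {glueA12})

/-- The vector `w = ((17/13, -9/13^5, 4/13^7), (7/13^6, -6/13^7))`. -/
def wA12 : Fin 26 → ℚ := fun i =>
  if i.val = 0 then 17 / 13 else if i.val < 6 then -(9 / 13)
  else if i.val < 13 then 4 / 13 else if i.val < 19 then 7 / 13 else -(6 / 13)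


/-- The index of the `i`-th coordinate of the first half. -/
def loIdx (i : Fin 13) : Fin 26 := ⟨i.val, by omega⟩

/-- The index of the `i`-th coordinate of the second half. -/
def hiIdx (i : Fin 13) : Fin 26 := ⟨13 + i.val, by omega⟩

theorem sum_split {M : Type*} [AddCommMonoid M] (f : Fin 26 → M) :
    ∑ i, f i = ∑ i, f (loIdx i) + ∑ i, f (hiIdx i) :=
  Fin.sum_univ_add (a := 13) (b := 13) f

theorem forall_split {p : Fin 26 → Prop} (h₁ : ∀ i, p (loIdx i)) (h₂ : ∀ i, p (hiIdx i)) :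
    ∀ i, p i := by
  intro i
  by_cases h : i.val < 13
  · exact h₁ ⟨i.val, h⟩
  · have := h₂ ⟨i.val - 13, by omega⟩
    have e : hiIdx ⟨i.val - 13, by omega⟩ = i := by
      apply Fin.ext
      simp only [hiIdx]
      omega
    rwa [e] at this

/-- The integral vectors `13 u` with `u` in the Niemeier lattice. -/
def IsScaled (x : Fin 26 → ℤ) : Prop :=
  (∀ i, 13 ∣ x (loIdx i) - x 0) ∧ (∀ i, 13 ∣ x (hiIdx i) - 5 * x 0) ∧
    ∑ i, x (loIdx i) = 0 ∧ ∑ i, x (hiIdx i) = 0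

instance (x : Fin 26 → ℤ) : Decidable (IsScaled x) := by
  unfold IsScaled
  infer_instance

/-- The rational vector `x / 13`. -/
def unscale (x : Fin 26 → ℤ) : Fin 26 → ℚ := fun i => (x i : ℚ) / 13

theorem unscale_injective : Function.Injective unscale := by
  intro x y h
  funext i
  have := congrFun h i
  simp only [unscale] at this
  have h' : (x i : ℚ) = y i := by linarith
  exact_mod_cast h'

/-- The scaled vector `13 g`. -/
def glueScaled : Fin 26 → ℤ := fun i =>
  if i.val < 12 then 1 else if i.val = 12 then -12 else if i.val < 21 then 5 else -8

/-- The scaled vector `13 w`. -/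
def wScaled : Fin 26 → ℤ := fun i =>
  if i.val = 0 then 17 else if i.val < 6 then -9
  else if i.val < 13 then 4 else if i.val < 19 then 7 else -6

theorem unscale_glueScaled : unscale glueScaled = glueA12 := by
  funext i
  simp only [unscale, glueScaled, glueA12]
  split_ifs <;> norm_num

theorem unscale_wScaled : unscale wScaled = wA12 := by
  funext i
  simp only [unscale, wScaled, wA12]
  split_ifs <;> norm_num

theorem qip_unscale (x y : Fin 26 → ℤ) :
    qip (unscale x) (unscale y) = ((∑ i, x i * y i : ℤ) : ℚ) / 169 := by
  simp only [qip, unscale]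
  push_cast
  rw [Finset.sum_div]
  refine Finset.sum_congr rfl fun i _ => ?_
  ring

theorem IsScaled.add {x y : Fin 26 → ℤ} (hx : IsScaled x) (hy : IsScaled y) :
    IsScaled (x + y) := by
  obtain ⟨a, b, c, d⟩ := hx
  obtain ⟨a', b', c', d'⟩ := hy
  refine ⟨fun i => ?_, fun i => ?_, ?_, ?_⟩
  · have := a i; have := a' i; simp only [Pi.add_apply]; omega
  · have := b i; have := b' i; simp only [Pi.add_apply]; omega
  · simp only [Pi.add_apply, Finset.sum_add_distrib, c, c', add_zero]
  · simp only [Pi.add_apply, Finset.sum_add_distrib, d, d', add_zero]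

theorem IsScaled.neg {x : Fin 26 → ℤ} (hx : IsScaled x) : IsScaled (-x) := by
  obtain ⟨a, b, c, d⟩ := hx
  refine ⟨fun i => ?_, fun i => ?_, ?_, ?_⟩
  · have := a i; simp only [Pi.neg_apply]; omega
  · have := b i; simp only [Pi.neg_apply]; omega
  · simp only [Pi.neg_apply, Finset.sum_neg_distrib, c, neg_zero]
  · simp only [Pi.neg_apply, Finset.sum_neg_distrib, d, neg_zero]

theorem exists_isScaled_of_mem {u : Fin 26 → ℚ} (hu : u ∈ NiemeierA12sq) :
    ∃ x, IsScaled x ∧ unscale x = u := by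
  unfold NiemeierA12sq at hu
  induction hu using AddSubgroup.closure_induction with
  | mem u hu =>
    have key : isIntVec u → ∑ i, u (loIdx i) = 0 → ∑ i, u (hiIdx i) = 0 →
        ∃ x, IsScaled x ∧ unscale x = u := by
      intro h h₁ h₂
      choose m hm using h
      simp only [hm] at h₁ h₂
      have e₁ : ∑ i, m (loIdx i) = 0 := by exact_mod_cast h₁
      have e₂ : ∑ i, m (hiIdx i) = 0 := by exact_mod_cast h₂
      refine ⟨fun i => 13 * m i, ⟨fun i => by dsimp only; omega, fun i => by dsimp only; omega, ?_, ?_⟩, ?_⟩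
      · rw [← Finset.mul_sum, e₁, mul_zero]
      · rw [← Finset.mul_sum, e₂, mul_zero]
      · funext i
        simp only [unscale, hm]
        push_cast
        ring
    rcases hu with (⟨h, hs, h0⟩ | ⟨h, hs, h0⟩) | rfl
    · have e : ∑ i, u (hiIdx i) = 0 :=
        Finset.sum_eq_zero fun i _ => h0 _ (by simp [hiIdx])
      rw [sum_split, e, add_zero] at hs
      exact key h hs e
    · have e : ∑ i, u (loIdx i) = 0 :=
        Finset.sum_eq_zero fun i _ => h0 _ (by simp [loIdx])
      rw [sum_split, e, zero_add] at hs
      exact key h e hs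
    · exact ⟨glueScaled, by decide, unscale_glueScaled⟩
  | zero => exact ⟨0, by decide, by funext i; simp [unscale]⟩
  | add u v _ _ hu hv =>
    obtain ⟨x, hx, rfl⟩ := hu
    obtain ⟨y, hy, rfl⟩ := hv
    refine ⟨x + y, hx.add hy, ?_⟩
    funext i
    simp only [unscale, Pi.add_apply]
    push_cast
    ring
  | neg u _ hu =>
    obtain ⟨x, hx, rfl⟩ := hu
    refine ⟨-x, hx.neg, ?_⟩
    funext i
    simp only [unscale, Pi.neg_apply]
    push_cast
    ring

theorem IsScaled.unscale_mem {x : Fin 26 → ℤ} (hx : IsScaled x) :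
    unscale x ∈ NiemeierA12sq := by
  obtain ⟨a, b, c, d⟩ := hx
  have hgl : ∀ i, (13 : ℤ) ∣ glueScaled (loIdx i) - 1 := by decide
  have hgh : ∀ i, (13 : ℤ) ∣ glueScaled (hiIdx i) - 5 := by decide
  have hdvd : ∀ i, (13 : ℤ) ∣ x i - x 0 * glueScaled i := by
    apply forall_split
    · intro i
      have := (a i).sub ((hgl i).mul_left (x 0))
      rwa [show x (loIdx i) - x 0 - x 0 * (glueScaled (loIdx i) - 1) =
        x (loIdx i) - x 0 * glueScaled (loIdx i) by ring] at this
    · intro i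
      have := (b i).sub ((hgh i).mul_left (x 0))
      rwa [show x (hiIdx i) - 5 * x 0 - x 0 * (glueScaled (hiIdx i) - 5) =
        x (hiIdx i) - x 0 * glueScaled (hiIdx i) by ring] at this
  choose m hm using hdvd
  have sl : ∑ i, glueScaled (loIdx i) = 0 := by decide
  have sh : ∑ i, glueScaled (hiIdx i) = 0 := by decide
  have ml : ∑ i, m (loIdx i) = 0 := by
    have h : ∑ i, (x (loIdx i) - x 0 * glueScaled (loIdx i)) = ∑ i, 13 * m (loIdx i) :=
      Finset.sum_congr rfl fun i _ => hm _
    rw [Finset.sum_sub_distrib, ← Finset.mul_sum, ← Finset.mul_sum, c, sl] at h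
    linarith
  have mh : ∑ i, m (hiIdx i) = 0 := by
    have h : ∑ i, (x (hiIdx i) - x 0 * glueScaled (hiIdx i)) = ∑ i, 13 * m (hiIdx i) :=
      Finset.sum_congr rfl fun i _ => hm _
    rw [Finset.sum_sub_distrib, ← Finset.mul_sum, ← Finset.mul_sum, d, sh] at h
    linarith
  have hA : (fun i : Fin 26 => if i.val < 13 then (m i : ℚ) else 0) ∈ A12a := by
    refine ⟨fun i => ⟨if i.val < 13 then m i else 0, by push_cast; rfl⟩, ?_, ?_⟩
    · rw [sum_split]
      simp only [loIdx, hiIdx, Fin.is_lt, if_true, add_lt_iff_neg_left, not_lt_zero, if_false,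
        Finset.sum_const_zero, add_zero]
      exact_mod_cast ml
    · intro i hi
      simp only [not_lt.mpr hi, if_false]
  have hB : (fun i : Fin 26 => if i.val < 13 then 0 else (m i : ℚ)) ∈ A12b := by
    refine ⟨fun i => ⟨if i.val < 13 then 0 else m i, by push_cast; rfl⟩, ?_, ?_⟩
    · rw [sum_split]
      simp only [loIdx, hiIdx, Fin.is_lt, if_true, add_lt_iff_neg_left, not_lt_zero, if_false,
        Finset.sum_const_zero, zero_add]
      exact_mod_cast mh
    · intro i hi
      simp only [hi, if_true]
  have e : unscale x = x 0 • glueA12 + (fun i : Fin 26 => if i.val < 13 then (m i : ℚ) else 0) +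
      (fun i : Fin 26 => if i.val < 13 then 0 else (m i : ℚ)) := by
    rw [← unscale_glueScaled]
    funext i
    have h : ((x i : ℚ) - x 0 * glueScaled i) = 13 * m i := by exact_mod_cast hm i
    simp only [unscale, Pi.add_apply, Pi.smul_apply]
    rw [zsmul_eq_mul]
    split_ifs <;> linarith
  rw [e]
  refine add_mem (add_mem (zsmul_mem ?_ _) ?_) ?_
  · exact AddSubgroup.subset_closure (Or.inr rfl)
  · exact AddSubgroup.subset_closure (Or.inl (Or.inl hA))
  · exact AddSubgroup.subset_closure (Or.inl (Or.inr hB))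

/-- The integral part of `w` on the first half, relative to the residue `4/13`. -/
def wLo : Fin 13 → ℤ := ![1, -1, -1, -1, -1, -1, 0, 0, 0, 0, 0, 0, 0]

/-- The integral part of `w` on the second half, relative to the residue `7/13`. -/
def wHi : Fin 13 → ℤ := ![0, 0, 0, 0, 0, 0, -1, -1, -1, -1, -1, -1, -1]

theorem mul_add_nonneg_of_sq_le_one {m n : ℤ} (h₁ : -1 ≤ n) (h₂ : n ≤ 1) :
    0 ≤ m * (m + n) := by
  rcases lt_trichotomy m 0 with h | h | h
  · exact mul_nonneg_of_nonpos_of_nonpos h.le (by omega)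
  · simp [h]
  · exact mul_nonneg h.le (by omega)

theorem mul_add_add_self_nonneg {m n : ℤ} (h₁ : -1 ≤ n) (h₂ : n ≤ 1) :
    0 ≤ m * (m + n) + m + (if n = 1 then 1 else 0) := by
  obtain rfl | rfl | rfl : n = -1 ∨ n = 0 ∨ n = 1 := by omega
  · simp; nlinarith [sq_nonneg m]
  · have := mul_add_nonneg_of_sq_le_one (m := m) (n := 1) (by norm_num) le_rfl
    simp; linarith
  · simp; nlinarith [sq_nonneg (m + 1)]

theorem mul_add_sub_self_nonneg {m n : ℤ} (h₁ : -1 ≤ n) (h₂ : n ≤ 1) :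
    0 ≤ m * (m + n) - m + (if n = -1 then 1 else 0) := by
  have := mul_add_add_self_nonneg (m := -m) (n := -n) (by omega) (by omega)
  have e : (-n = 1) ↔ n = -1 := by omega
  simp only [e] at this
  linarith

theorem sum_affine_mul (r s : ℤ) (c n : Fin 13 → ℤ) :
    ∑ i, (r + 13 * c i) * (s + 13 * n i) =
      13 * r * s + 13 * s * ∑ i, c i + 13 * r * ∑ i, n i + 169 * ∑ i, c i * n i := by
  have h13 : 13 * r * s = ∑ _i : Fin 13, r * s := by
    simp; ring
  rw [h13, Finset.mul_sum, Finset.mul_sum, Finset.mul_sum]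
  simp only [← Finset.sum_add_distrib]
  exact Finset.sum_congr rfl fun i _ => by ring

theorem sum_affine_form (r s : ℤ) (c n : Fin 13 → ℤ) :
    ∑ i, (r + 13 * c i) * (r + 13 * c i) + ∑ i, (r + 13 * c i) * (s + 13 * n i) =
      13 * r * (r + s) + 13 * (2 * r + s) * ∑ i, c i + 13 * r * ∑ i, n i +
        169 * ∑ i, c i * (c i + n i) := by
  rw [sum_affine_mul r s c n, sum_affine_mul r r c c]
  simp only [mul_add, Finset.sum_add_distrib]
  ring

/-- The decomposition of the scaled form `u · (u + w)` into integral parts. -/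
theorem scaled_form_decomposition {x : Fin 26 → ℤ} (hx : IsScaled x) :
    ∃ (k l : ℤ) (a b : Fin 13 → ℤ), -8 ≤ k ∧ k ≤ 4 ∧ -10 ≤ l ∧ l ≤ 2 ∧ 13 ∣ l - 5 * k ∧
      (∀ i, x (loIdx i) = k + 13 * a i) ∧ (∀ i, x (hiIdx i) = l + 13 * b i) ∧
      ∑ i, a i = -k ∧ ∑ i, b i = -l ∧
      ∑ i, x i * x i + ∑ i, x i * wScaled i =
        169 * (∑ i, a i * (a i + wLo i) + ∑ i, b i * (b i + wHi i))
          - 13 * (k ^ 2 + 4 * k + l ^ 2 + 7 * l) ∧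
      ∑ i, x i * wScaled i =
        169 * (∑ i, a i * wLo i + ∑ i, b i * wHi i) - 52 * k - 91 * l := by
  obtain ⟨hlo, hhi, slo, shi⟩ := hx
  obtain ⟨k, hk₁, hk₂, hk⟩ : ∃ k : ℤ, -8 ≤ k ∧ k ≤ 4 ∧ 13 ∣ x 0 - k :=
    ⟨(x 0 + 8) % 13 - 8, by omega, by omega, by omega⟩
  obtain ⟨l, hl₁, hl₂, hl⟩ : ∃ l : ℤ, -10 ≤ l ∧ l ≤ 2 ∧ 13 ∣ 5 * x 0 - l :=
    ⟨(5 * x 0 + 10) % 13 - 10, by omega, by omega, by omega⟩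
  have ha : ∀ i, ∃ c, x (loIdx i) = k + 13 * c := fun i => by
    have := hlo i
    exact ⟨(x (loIdx i) - k) / 13, by omega⟩
  have hb : ∀ i, ∃ c, x (hiIdx i) = l + 13 * c := fun i => by
    have := hhi i
    exact ⟨(x (hiIdx i) - l) / 13, by omega⟩
  choose a ha using ha
  choose b hb using hb
  have wl : ∀ i, wScaled (loIdx i) = 4 + 13 * wLo i := by decide
  have wh : ∀ i, wScaled (hiIdx i) = 7 + 13 * wHi i := by decide
  have nl : ∑ i, wLo i = -4 := by decide
  have nh : ∑ i, wHi i = -7 := by decide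
  have sa : ∑ i, a i = -k := by
    simp only [ha, Finset.sum_add_distrib, ← Finset.mul_sum, Finset.sum_const, Finset.card_univ,
      Fintype.card_fin, nsmul_eq_mul] at slo
    push_cast at slo
    linarith
  have sb : ∑ i, b i = -l := by
    simp only [hb, Finset.sum_add_distrib, ← Finset.mul_sum, Finset.sum_const, Finset.card_univ,
      Fintype.card_fin, nsmul_eq_mul] at shi
    push_cast at shi
    linarith
  refine ⟨k, l, a, b, hk₁, hk₂, hl₁, hl₂, by omega, ha, hb, sa, sb, ?_, ?_⟩
  · have h₁ := sum_affine_form k 4 a wLo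
    have h₂ := sum_affine_form l 7 b wHi
    rw [sa, nl] at h₁
    rw [sb, nh] at h₂
    rw [sum_split, sum_split (fun i => x i * wScaled i)]
    simp only [ha, hb, wl, wh]
    linarith
  · have h₁ := sum_affine_mul k 4 a wLo
    have h₂ := sum_affine_mul l 7 b wHi
    rw [sa, nl] at h₁
    rw [sb, nh] at h₂
    rw [sum_split]
    simp only [ha, hb, wl, wh]
    linarith

theorem half_lower_bounds (a n : Fin 13 → ℤ) (h₁ : ∀ i, -1 ≤ n i) (h₂ : ∀ i, n i ≤ 1) :
    0 ≤ ∑ i, a i * (a i + n i) ∧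
    0 ≤ ∑ i, a i * (a i + n i) + ∑ i, a i + ∑ i, (if n i = 1 then 1 else 0) ∧
    0 ≤ ∑ i, a i * (a i + n i) - ∑ i, a i + ∑ i, (if n i = -1 then 1 else 0) := by
  refine ⟨Finset.sum_nonneg fun i _ => mul_add_nonneg_of_sq_le_one (h₁ i) (h₂ i), ?_, ?_⟩
  · rw [← Finset.sum_add_distrib, ← Finset.sum_add_distrib]
    exact Finset.sum_nonneg fun i _ => mul_add_add_self_nonneg (h₁ i) (h₂ i)
  · rw [← Finset.sum_sub_distrib, ← Finset.sum_add_distrib]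
    exact Finset.sum_nonneg fun i _ => mul_add_sub_self_nonneg (h₁ i) (h₂ i)

theorem scaled_form_bounds {k l A B : ℤ} (hk₁ : -8 ≤ k) (hk₂ : k ≤ 4) (hl₁ : -10 ≤ l)
    (hl₂ : l ≤ 2) (hkl : 13 ∣ l - 5 * k) (hA : 0 ≤ A) (hA₁ : 0 ≤ A - k + 1)
    (hA₂ : 0 ≤ A + k + 5) (hB : 0 ≤ B) (hB₁ : 0 ≤ B - l) (hB₂ : 0 ≤ B + l + 7) :
    0 ≤ 169 * (A + B) - 13 * (k ^ 2 + 4 * k + l ^ 2 + 7 * l) ∧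
    (169 * (A + B) - 13 * (k ^ 2 + 4 * k + l ^ 2 + 7 * l) = 0 →
      (k = 0 ∧ l = 0 ∧ A = 0 ∧ B = 0) ∨ (k = -4 ∧ l = -7 ∧ A = 0 ∧ B = 0) ∨
      (k = 1 ∧ l = -8 ∧ A = 0 ∧ B = 1) ∨ (k = -5 ∧ l = 1 ∧ A = 0 ∧ B = 1)) := by
  obtain ⟨t, ht⟩ := hkl
  obtain rfl : l = 5 * k + 13 * t := by omega
  have ht₁ : -2 ≤ t := by omega
  have ht₂ : t ≤ 3 := by omega
  interval_cases k <;> interval_cases t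
  all_goals first | (exfalso; omega) | skip
  all_goals
    constructor
    · norm_num
      omega
    · intro h
      norm_num at h ⊢
      omega

theorem wLo_bounds : (∀ i, -1 ≤ wLo i) ∧ ∀ i, wLo i ≤ 1 := by decide

theorem wHi_bounds : (∀ i, -1 ≤ wHi i) ∧ ∀ i, wHi i ≤ 1 := by decide

theorem scaled_form_cases {x : Fin 26 → ℤ} (hx : IsScaled x) :
    ∃ (k l : ℤ) (a b : Fin 13 → ℤ),
      (∀ i, x (loIdx i) = k + 13 * a i) ∧ (∀ i, x (hiIdx i) = l + 13 * b i) ∧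
      ∑ i, a i = -k ∧ ∑ i, b i = -l ∧
      ∑ i, x i * wScaled i =
        169 * (∑ i, a i * wLo i + ∑ i, b i * wHi i) - 52 * k - 91 * l ∧
      0 ≤ ∑ i, x i * x i + ∑ i, x i * wScaled i ∧
      (∑ i, x i * x i + ∑ i, x i * wScaled i = 0 →
        ∑ i, a i * (a i + wLo i) = 0 ∧
        ((k = 0 ∧ l = 0 ∧ ∑ i, b i * (b i + wHi i) = 0) ∨
        (k = -4 ∧ l = -7 ∧ ∑ i, b i * (b i + wHi i) = 0) ∨
        (k = 1 ∧ l = -8 ∧ ∑ i, b i * (b i + wHi i) = 1) ∨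
        (k = -5 ∧ l = 1 ∧ ∑ i, b i * (b i + wHi i) = 1))) := by
  obtain ⟨k, l, a, b, hk₁, hk₂, hl₁, hl₂, hkl, ha, hb, sa, sb, hQ, hw⟩ :=
    scaled_form_decomposition hx
  obtain ⟨hA, hA₁, hA₂⟩ := half_lower_bounds a wLo wLo_bounds.1 wLo_bounds.2
  obtain ⟨hB, hB₁, hB₂⟩ := half_lower_bounds b wHi wHi_bounds.1 wHi_bounds.2
  have c₁ : ∑ i, (if wLo i = 1 then (1 : ℤ) else 0) = 1 := by decide
  have c₂ : ∑ i, (if wLo i = -1 then (1 : ℤ) else 0) = 5 := by decide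
  have c₃ : ∑ i, (if wHi i = 1 then (1 : ℤ) else 0) = 0 := by decide
  have c₄ : ∑ i, (if wHi i = -1 then (1 : ℤ) else 0) = 7 := by decide
  obtain ⟨h0, h⟩ := scaled_form_bounds hk₁ hk₂ hl₁ hl₂ hkl hA (by linarith) (by linarith) hB
    (by linarith) (by linarith)
  refine ⟨k, l, a, b, ha, hb, sa, sb, hw, hQ ▸ h0, fun h' => ?_⟩
  rcases h (hQ ▸ h') with ⟨h₁, h₂, h₃, h₄⟩ | ⟨h₁, h₂, h₃, h₄⟩ | ⟨h₁, h₂, h₃, h₄⟩ |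
    ⟨h₁, h₂, h₃, h₄⟩ <;> simp [h₁, h₂, h₃, h₄]

theorem eq_zero_or_of_half_sum_eq_zero {a n : Fin 13 → ℤ} (h₁ : ∀ i, -1 ≤ n i)
    (h₂ : ∀ i, n i ≤ 1) (h : ∑ i, a i * (a i + n i) = 0) (i : Fin 13) :
    a i = 0 ∨ a i + n i = 0 := by
  have := (Finset.sum_eq_zero_iff_of_nonneg fun i _ =>
    mul_add_nonneg_of_sq_le_one (h₁ i) (h₂ i)).mp h i (Finset.mem_univ i)
  exact mul_eq_zero.mp this

/-- The vectors of `S_2`, scaled by `13`. -/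
def rootScaled (j : Fin 5) : Fin 26 → ℤ := fun i =>
  if i.val = 0 then -13 else if i.val = j.val + 1 then 13 else 0

/-- The vectors of `S_4`, scaled by `13`. -/
def normFourScaled (s : Bool × Fin 6) : Fin 26 → ℤ := fun i =>
  if s.1 then
    if i.val = 0 then -12 else if i.val < 13 then 1
    else if i.val = 13 + s.2.val then 5 else if i.val < 19 then -8 else 5
  else
    if i.val = 0 then -5 else if i.val < 6 then 8 else if i.val < 13 then -5
    else if i.val = 13 + s.2.val then -12 else 1

theorem rootScaled_injective : Function.Injective rootScaled := by
  intro j j' h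
  have := congrFun h ⟨j.val + 1, by omega⟩
  simp [rootScaled] at this
  omega

theorem normFourScaled_injective : Function.Injective normFourScaled := by
  unfold Function.Injective
  decide

theorem rootScaled_spec : ∀ j, IsScaled (rootScaled j) ∧
    ∑ i, rootScaled j i * rootScaled j i = 338 ∧
    ∑ i, rootScaled j i * wScaled i = -338 := by
  decide

theorem normFourScaled_spec : ∀ s, IsScaled (normFourScaled s) ∧
    ∑ i, normFourScaled s i * normFourScaled s i = 676 ∧
    ∑ i, normFourScaled s i * wScaled i = -676 := by
  decide

theorem exists_eq_one_of_sum_eq_one {ι : Type*} [Fintype ι] [DecidableEq ι] {c : ι → ℤ}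
    (h : ∀ i, 0 ≤ c i) (hs : ∑ i, c i = 1) : ∃ j, c j = 1 ∧ ∀ i, i ≠ j → c i = 0 := by
  obtain ⟨j, -, hj⟩ : ∃ j ∈ Finset.univ, c j ≠ 0 :=
    Finset.exists_ne_zero_of_sum_ne_zero (by rw [hs]; exact one_ne_zero)
  have hpos : 1 ≤ c j := by have := h j; omega
  have hsplit := Finset.add_sum_erase Finset.univ c (Finset.mem_univ j)
  have hnn : 0 ≤ ∑ i ∈ Finset.univ.erase j, c i := Finset.sum_nonneg fun i _ => h i
  have hz : ∑ i ∈ Finset.univ.erase j, c i = 0 := by omega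
  refine ⟨j, by omega, fun i hi => ?_⟩
  exact (Finset.sum_eq_zero_iff_of_nonneg fun i _ => h i).mp hz i
    (Finset.mem_erase.mpr ⟨hi, Finset.mem_univ i⟩)

theorem wLo_eq (i : Fin 13) :
    wLo i = if i.val = 0 then 1 else if i.val ≤ 5 then -1 else 0 := by
  revert i; decide

theorem wHi_eq (i : Fin 13) : wHi i = if i.val ≤ 5 then 0 else -1 := by
  revert i; decide

theorem coords_of_lo_sum_eq_zero {a : Fin 13 → ℤ} (h : ∑ i, a i * (a i + wLo i) = 0)
    (i : Fin 13) :
    a i = 0 ∨ (i.val = 0 ∧ a i = -1) ∨ (i.val ≠ 0 ∧ i.val ≤ 5 ∧ a i = 1) := by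
  have := eq_zero_or_of_half_sum_eq_zero wLo_bounds.1 wLo_bounds.2 h i
  rw [wLo_eq] at this
  split_ifs at this <;> omega

theorem coords_of_hi_sum_eq_zero {b : Fin 13 → ℤ} (h : ∑ i, b i * (b i + wHi i) = 0)
    (i : Fin 13) : b i = 0 ∨ (6 ≤ i.val ∧ b i = 1) := by
  have := eq_zero_or_of_half_sum_eq_zero wHi_bounds.1 wHi_bounds.2 h i
  rw [wHi_eq] at this
  split_ifs at this <;> omega

theorem coords_of_hi_sum_eq_eight {b : Fin 13 → ℤ} (h : ∑ i, b i * (b i + wHi i) = 1)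
    (hs : ∑ i, b i = 8) (i : Fin 13) : b i = 1 ∨ (i.val ≤ 5 ∧ b i = 0) := by
  have nn : ∀ i ∈ Finset.univ, 0 ≤ (b i + wHi i) * (b i - 1) := by
    intro i _
    rw [wHi_eq]
    split_ifs
    · have := mul_add_nonneg_of_sq_le_one (m := b i) (n := -1) le_rfl (by norm_num)
      linarith
    · nlinarith [sq_nonneg (b i - 1)]
  have hz : ∑ i, (b i + wHi i) * (b i - 1) = 0 := by
    have e : ∀ i, (b i + wHi i) * (b i - 1) = b i * (b i + wHi i) - b i - wHi i := by
      intro i; ring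
    have nh : ∑ i, wHi i = -7 := by decide
    simp only [e, Finset.sum_sub_distrib, h, hs, nh]
    norm_num
  have := mul_eq_zero.mp ((Finset.sum_eq_zero_iff_of_nonneg nn).mp hz i (Finset.mem_univ i))
  rw [wHi_eq] at this
  split_ifs at this <;> omega

theorem coords_of_hi_sum_eq_neg_one {b : Fin 13 → ℤ} (h : ∑ i, b i * (b i + wHi i) = 1)
    (hs : ∑ i, b i = -1) (i : Fin 13) : b i = 0 ∨ (i.val ≤ 5 ∧ b i = -1) := by
  have nn : ∀ i ∈ Finset.univ, 0 ≤ b i * (b i + wHi i + 1) := by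
    intro i _
    rw [wHi_eq]
    split_ifs
    · have := mul_add_nonneg_of_sq_le_one (m := b i) (n := 1) (by norm_num) le_rfl
      linarith
    · nlinarith [sq_nonneg (b i)]
  have hz : ∑ i, b i * (b i + wHi i + 1) = 0 := by
    have e : ∀ i, b i * (b i + wHi i + 1) = b i * (b i + wHi i) + b i := by
      intro i; ring
    simp only [e, Finset.sum_add_distrib, h, hs]
    norm_num
  have := mul_eq_zero.mp ((Finset.sum_eq_zero_iff_of_nonneg nn).mp hz i (Finset.mem_univ i))
  rw [wHi_eq] at this
  split_ifs at this <;> omega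

theorem sum_mul_wLo (a : Fin 13 → ℤ) :
    ∑ i, a i * wLo i = a 0 - (a 1 + a 2 + a 3 + a 4 + a 5) := by
  simp [Fin.sum_univ_succ, wLo]
  ring

theorem sum_mul_wHi (b : Fin 13 → ℤ) :
    ∑ i, b i * wHi i = -(b 6 + b 7 + b 8 + b 9 + b 10 + b 11 + b 12) := by
  simp [Fin.sum_univ_succ, wHi]
  ring

theorem sum_of_lo_sum_eq_zero {a : Fin 13 → ℤ} (h : ∑ i, a i * (a i + wLo i) = 0) :
    ∑ i, a i = a 0 + (a 1 + a 2 + a 3 + a 4 + a 5) := by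
  have ha := coords_of_lo_sum_eq_zero h
  have z : ∀ i : Fin 13, 6 ≤ i.val → a i = 0 := fun i hi => by have := ha i; omega
  simp [Fin.sum_univ_succ, z]
  ring

theorem sum_mul_wHi_of_hi_sum_eq_zero {b : Fin 13 → ℤ}
    (h : ∑ i, b i * (b i + wHi i) = 0) : ∑ i, b i * wHi i = -∑ i, b i := by
  rw [← Finset.sum_neg_distrib]
  refine Finset.sum_congr rfl fun i _ => ?_
  rcases coords_of_hi_sum_eq_zero h i with h | ⟨hi, h⟩
  · simp [h]
  · rw [h, wHi_eq, if_neg (by omega)]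
    norm_num

theorem sum_mul_wHi_eq_of_const {b : Fin 13 → ℤ} {t : ℤ}
    (h : ∀ i : Fin 13, 6 ≤ i.val → b i = t) : ∑ i, b i * wHi i = -7 * t := by
  rw [sum_mul_wHi, h 6 (by decide), h 7 (by decide), h 8 (by decide), h 9 (by decide),
    h 10 (by decide), h 11 (by decide), h 12 (by decide)]
  ring

/-- The integral solutions of `u · (u + w) = 0` with `u · w = -2` or `u · w = -4`. -/
theorem zero_form_cases {x : Fin 26 → ℤ} {q : ℤ} (hx : IsScaled x)
    (h₁ : ∑ i, x i * x i = q) (h₂ : ∑ i, x i * wScaled i = -q) (hq : q = 338 ∨ q = 676) :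
    (q = 338 ∧ ∃ j, rootScaled j = x) ∨ (q = 676 ∧ ∃ s, normFourScaled s = x) := by
  obtain ⟨k, l, a, b, ha, hb, sa, sb, hw, -, hQ⟩ := scaled_form_cases hx
  obtain ⟨hA, hcase⟩ := hQ (by rw [h₁, h₂]; ring)
  have ea := coords_of_lo_sum_eq_zero hA
  rw [h₂, sum_mul_wLo] at hw
  have sa' := sa
  rw [sum_of_lo_sum_eq_zero hA] at sa'
  have ea0 : a 0 = 0 ∨ a 0 = -1 := by
    have := ea 0
    simp only [Fin.val_zero] at this
    omega
  have ea5 : ∀ i : Fin 13, i.val ≠ 0 → i.val ≤ 5 → 0 ≤ a i ∧ a i ≤ 1 := by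
    intro i hi hi'
    have := ea i
    omega
  have e1 := ea5 1 (by decide) (by decide)
  have e2 := ea5 2 (by decide) (by decide)
  have e3 := ea5 3 (by decide) (by decide)
  have e4 := ea5 4 (by decide) (by decide)
  have e5 := ea5 5 (by decide) (by decide)
  rcases hcase with ⟨rfl, rfl, hB⟩ | ⟨rfl, rfl, hB⟩ | ⟨rfl, rfl, hB⟩ | ⟨rfl, rfl, hB⟩
  · rw [sum_mul_wHi_of_hi_sum_eq_zero hB, sb] at hw
    have a0 : a 0 = -1 := by omega
    refine Or.inl ⟨by omega, ?_⟩
    have eb := coords_of_hi_sum_eq_zero hB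
    have bz : ∀ i, b i = 0 := fun i =>
      (Finset.sum_eq_zero_iff_of_nonneg fun i _ => by have := eb i; omega).mp
        (by simpa using sb) i (Finset.mem_univ i)
    obtain ⟨j, hj, hj'⟩ := exists_eq_one_of_sum_eq_one
      (c := fun i => a i + if i = 0 then 1 else 0)
      (fun i => by
        by_cases hi : i = 0
        · subst hi; simp [a0]
        · have := ea i
          have := Fin.val_ne_of_ne hi
          simp only [hi, if_false, Fin.val_zero] at *
          omega)
      (by simp [Finset.sum_add_distrib, sa])
    have j0 : j.val ≠ 0 := by
      intro h
      obtain rfl : j = 0 := Fin.ext h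
      simp [a0] at hj
    have aj : a j = 1 := by
      have : j ≠ 0 := fun h => j0 (by rw [h]; rfl)
      simpa [this] using hj
    have j5 : j.val ≤ 5 := by have := ea j; omega
    refine ⟨⟨j.val - 1, by omega⟩, funext (forall_split (fun i => ?_) fun i => ?_)⟩
    · rw [ha]
      by_cases hi : i = j
      · subst hi
        simp only [rootScaled, loIdx]
        split_ifs <;> omega
      · have hv := Fin.val_ne_of_ne hi
        have := hj' i hi
        simp only [rootScaled, loIdx, Fin.ext_iff, Fin.val_zero] at this ⊢
        split_ifs at this ⊢ <;> omega
    · rw [hb, bz]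
      simp only [rootScaled, hiIdx]
      split_ifs <;> omega
  · rw [sum_mul_wHi_of_hi_sum_eq_zero hB, sb] at hw
    omega
  · have eb := coords_of_hi_sum_eq_eight hB sb
    rw [sum_mul_wHi_eq_of_const (t := 1) fun i hi => by have := eb i; omega] at hw
    refine Or.inr ⟨by omega, ?_⟩
    have a0 : a 0 = -1 := by omega
    have az : ∀ i : Fin 13, i.val ≠ 0 → a i = 0 := by
      have hle : ∀ i ∈ Finset.univ, 0 ≤ a i + if i = 0 then 1 else 0 := by
        intro i _
        by_cases hi : i = 0
        · subst hi; simp [a0]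
        · have := ea i
          have := Fin.val_ne_of_ne hi
          simp only [hi, if_false, Fin.val_zero] at *
          omega
      intro i hi
      have := (Finset.sum_eq_zero_iff_of_nonneg hle).mp
        (by simp [Finset.sum_add_distrib, sa]) i (Finset.mem_univ i)
      have hne : i ≠ 0 := fun h => hi (by rw [h]; rfl)
      simpa [hne] using this
    obtain ⟨j, hj, hj'⟩ := exists_eq_one_of_sum_eq_one (c := fun i => b i + wHi i)
      (fun i => by
        have := eb i
        rw [wHi_eq]
        split_ifs <;> omega)
      (by
        have nh : ∑ i, wHi i = -7 := by decide
        rw [Finset.sum_add_distrib, sb, nh]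
        norm_num)
    simp only [wHi_eq] at hj hj'
    have j5 : j.val < 6 := by
      have := eb j
      split_ifs at hj <;> omega
    refine ⟨(true, ⟨j.val, j5⟩), funext (forall_split (fun i => ?_) fun i => ?_)⟩
    · rw [ha]
      have := az i
      have : i.val = 0 → a i = -1 := fun h => by
        obtain rfl : i = 0 := Fin.ext h
        exact a0
      simp only [normFourScaled, loIdx, if_true]
      split_ifs <;> omega
    · rw [hb]
      have := hj' i
      have := eb i
      have : i.val = j.val → b i = b j := fun h => by rw [Fin.ext h]
      simp only [normFourScaled, hiIdx, if_true, ne_eq, Fin.ext_iff] at *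
      split_ifs at * <;> omega
  · have eb := coords_of_hi_sum_eq_neg_one hB sb
    rw [sum_mul_wHi_eq_of_const (t := 0) fun i hi => by have := eb i; omega] at hw
    refine Or.inr ⟨by omega, ?_⟩
    have av : ∀ i : Fin 13, a i = if i.val = 0 then 0 else if i.val ≤ 5 then 1 else 0 := by
      have h0 : a 0 = 0 := by omega
      have h1 : a 1 = 1 := by omega
      have h2 : a 2 = 1 := by omega
      have h3 : a 3 = 1 := by omega
      have h4 : a 4 = 1 := by omega
      have h5 : a 5 = 1 := by omega
      intro i
      by_cases hi : 6 ≤ i.val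
      · have := ea i
        split_ifs <;> omega
      · have : i = 0 ∨ i = 1 ∨ i = 2 ∨ i = 3 ∨ i = 4 ∨ i = 5 := by
          revert i; decide
        rcases this with rfl | rfl | rfl | rfl | rfl | rfl <;> simpa
    obtain ⟨j, hj, hj'⟩ := exists_eq_one_of_sum_eq_one (c := fun i => -b i)
      (fun i => by have := eb i; omega)
      (by rw [Finset.sum_neg_distrib, sb]; norm_num)
    have j5 : j.val < 6 := by have := eb j; omega
    refine ⟨(false, ⟨j.val, j5⟩), funext (forall_split (fun i => ?_) fun i => ?_)⟩
    · rw [ha, av]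
      simp only [normFourScaled, loIdx]
      simp only [Bool.false_eq_true, if_false]
      split_ifs <;> omega
    · rw [hb]
      have := hj' i
      have : i.val = j.val → b i = b j := fun h => by rw [Fin.ext h]
      simp only [normFourScaled, hiIdx, ne_eq, Fin.ext_iff] at *
      split_ifs at * <;> omega

theorem shortVectors_eq_range {ι : Type*} {q : ℤ} (f : ι → Fin 26 → ℤ)
    (hf : ∀ j, IsScaled (f j) ∧ ∑ i, f j i * f j i = 169 * q ∧
      ∑ i, f j i * wScaled i = -(169 * q))
    (hf' : ∀ x, IsScaled x → ∑ i, x i * x i = 169 * q → ∑ i, x i * wScaled i = -(169 * q) →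
      ∃ j, f j = x) :
    {u : Fin 26 → ℚ | u ∈ NiemeierA12sq ∧ qip u u = q ∧ qip u wA12 = -q} =
      Set.range (unscale ∘ f) := by
  ext u
  constructor
  · rintro ⟨hu, h₁, h₂⟩
    obtain ⟨x, hx, rfl⟩ := exists_isScaled_of_mem hu
    rw [qip_unscale, div_eq_iff (by norm_num)] at h₁
    rw [← unscale_wScaled, qip_unscale, div_eq_iff (by norm_num)] at h₂
    have e₁ : ∑ i, x i * x i = q * 169 := by exact_mod_cast h₁
    have e₂ : ∑ i, x i * wScaled i = -q * 169 := by exact_mod_cast h₂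
    obtain ⟨j, rfl⟩ := hf' x hx (by linarith) (by linarith)
    exact ⟨j, rfl⟩
  · rintro ⟨j, rfl⟩
    obtain ⟨h, h₁, h₂⟩ := hf j
    simp only [Set.mem_ofPred_eq, Function.comp_apply]
    refine ⟨h.unscale_mem, ?_, ?_⟩
    · rw [qip_unscale, h₁]
      push_cast
      ring
    · rw [← unscale_wScaled, qip_unscale, h₂]
      push_cast
      ring

theorem card_roots : Nat.card {u : Fin 26 → ℚ |
    u ∈ NiemeierA12sq ∧ qip u u = 2 ∧ qip u wA12 = -2} = 5 := by
  have h := shortVectors_eq_range (q := 2) rootScaled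
    (fun j => by simpa using rootScaled_spec j) (fun x hx h₁ h₂ => by
      rcases zero_form_cases hx h₁ h₂ (by norm_num) with ⟨-, h⟩ | ⟨h, -⟩
      · exact h
      · norm_num at h)
  push_cast at h
  rw [h, Nat.card_range_of_injective (unscale_injective.comp rootScaled_injective)]
  simp

theorem card_normFour : Nat.card {u : Fin 26 → ℚ |
    u ∈ NiemeierA12sq ∧ qip u u = 4 ∧ qip u wA12 = -4} = 12 := by
  have h := shortVectors_eq_range (q := 4) normFourScaled
    (fun j => by simpa using normFourScaled_spec j) (fun x hx h₁ h₂ => by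
      rcases zero_form_cases hx h₁ h₂ (by norm_num) with ⟨h, -⟩ | ⟨-, h⟩
      · norm_num at h
      · exact h)
  push_cast at h
  rw [h, Nat.card_range_of_injective (unscale_injective.comp normFourScaled_injective)]
  simp

theorem qip_wA12_self : qip wA12 wA12 = 8 := by
  have h : ∑ i, wScaled i * wScaled i = 1352 := by decide
  rw [← unscale_wScaled, qip_unscale, h]
  norm_num

theorem qip_wA12_le {u : Fin 26 → ℚ} (hu : u ∈ NiemeierA12sq) :
    qip wA12 wA12 ≤ qip (wA12 + 2 • u) (wA12 + 2 • u) := by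
  have e : qip (wA12 + 2 • u) (wA12 + 2 • u) =
      qip wA12 wA12 + 4 * (qip u u + qip u wA12) := by
    simp only [qip, two_nsmul, Pi.add_apply]
    rw [← Finset.sum_add_distrib, Finset.mul_sum, ← Finset.sum_add_distrib]
    refine Finset.sum_congr rfl fun i _ => ?_
    ring
  have h : 0 ≤ qip u u + qip u wA12 := by
    obtain ⟨x, hx, rfl⟩ := exists_isScaled_of_mem hu
    obtain ⟨-, -, -, -, -, -, -, -, -, hQ, -⟩ := scaled_form_cases hx
    rw [← unscale_wScaled, qip_unscale, qip_unscale, ← add_div]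
    have : (0 : ℚ) ≤ ((∑ i, x i * x i + ∑ i, x i * wScaled i : ℤ) : ℚ) := by exact_mod_cast hQ
    push_cast at this ⊢
    positivity
  rw [e]
  linarith

theorem wA12_mem : wA12 ∈ NiemeierA12sq := by
  rw [← unscale_wScaled]
  exact IsScaled.unscale_mem (by decide)

/-- `w` lies in the Niemeier lattice `A_12²`, has norm 8, is
extremal; exactly 5 roots `u` satisfy `u·w = -2`, exactly 12 norm-4 vectors `u`
satisfy `u·w = -4`, so `1 + |S_2^w| + (1/2)|S_4^w| = 12 ≢ 0 (mod 8)`. -/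
theorem niemeierA12sq_w :
    wA12 ∈ NiemeierA12sq ∧
    qip wA12 wA12 = 8 ∧
    (∀ u ∈ NiemeierA12sq, qip wA12 wA12 ≤ qip (wA12 + 2 • u) (wA12 + 2 • u)) ∧
    Nat.card {u : Fin 26 → ℚ |
      u ∈ NiemeierA12sq ∧ qip u u = 2 ∧ qip u wA12 = -2} = 5 ∧
    Nat.card {u : Fin 26 → ℚ |
      u ∈ NiemeierA12sq ∧ qip u u = 4 ∧ qip u wA12 = -4} = 12 ∧
    1 + Nat.card {u : Fin 26 → ℚ |
        u ∈ NiemeierA12sq ∧ qip u u = 2 ∧ qip u wA12 = -2} +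
      Nat.card {u : Fin 26 → ℚ |
        u ∈ NiemeierA12sq ∧ qip u u = 4 ∧ qip u wA12 = -4} / 2 = 12 ∧
    ¬ (12 % 8 = 0) := by
  refine ⟨wA12_mem, qip_wA12_self, fun u hu => qip_wA12_le hu, card_roots, card_normFour, ?_,
    by norm_num⟩
  rw [card_roots, card_normFour]
end

section
/- For any Niemeier lattice L (even positive definite unimodular lattice of rank 24) with a_i the number of vectors of norm i, the identities a_4 = 196560 - 24·a_2, a_6 = 16773120 + 252·a_2, and a_8 = 398034000 - 1472·a_2 hold. -/
open scoped Matrix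

section PoissonSummation

open MeasureTheory TopologicalSpace Set

/-- The function on the torus obtained by summing a rapidly decreasing continuous function over
the integer translates. -/
theorem exists_torus_periodization {ι : Type*} [Finite ι] (f : C(ι → ℝ, ℂ))
    (hf : ∀ K : Compacts (ι → ℝ), Summable fun v : ι → ℤ ↦
      ‖(f.comp (ContinuousMap.addRight fun i ↦ (v i : ℝ))).restrict K‖) :
    ∃ F : C(UnitAddTorus ι, ℂ), ∀ x : ι → ℝ,
      HasSum (fun v : ι → ℤ ↦ f (x + fun i ↦ (v i : ℝ))) (F fun i ↦ (x i : UnitAddCircle)) := by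
  have hsum := ContinuousMap.summable_of_locally_summable_norm hf
  have hg (x : ι → ℝ) := ContinuousMap.hasSum_apply hsum.hasSum x
  set g := ∑' v : ι → ℤ, f.comp (ContinuousMap.addRight fun i ↦ (v i : ℝ))
  simp only [ContinuousMap.comp_apply, ContinuousMap.coe_addRight] at hg
  have hπ : IsOpenQuotientMap (Pi.map fun (_ : ι) (t : ℝ) ↦ (t : UnitAddCircle)) :=
    .piMap fun _ ↦ QuotientAddGroup.isOpenQuotientMap_mk
  let p : C(ι → ℝ, UnitAddTorus ι) := ⟨_, hπ.continuous⟩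
  have hp : Topology.IsQuotientMap p := hπ.isQuotientMap
  have hgp : Function.FactorsThrough g p := by
    intro x y hxy
    have hxy (i : ι) : ∃ n : ℤ, x i + n = y i := by
      have hi : ((y i - x i : ℝ) : UnitAddCircle) = 0 := by
        rw [AddCircle.coe_sub, sub_eq_zero]
        exact (congrFun hxy i).symm
      obtain ⟨n, hn⟩ := AddCircle.coe_eq_zero_iff 1 |>.mp hi
      rw [zsmul_one] at hn
      exact ⟨n, by linarith⟩
    choose n hn using hxy
    refine ((Equiv.addRight n).hasSum_iff.mpr (hg x)).unique ?_
    convert! hg y using 2 with v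
    refine congrArg f (funext fun i ↦ ?_)
    simp [← hn i]
    ring
  refine ⟨hp.lift g hgp, fun x ↦ ?_⟩
  have : hp.lift g hgp (p x) = g x := DFunLike.congr_fun (hp.lift_comp g hgp) x
  exact this ▸ hg x

/-- The integral over `ℝⁿ` is the sum of the integrals over the integer translates of the unit
cube. -/
theorem hasSum_setIntegral_unit_cube {ι E : Type*} [Fintype ι] [NormedAddCommGroup E]
    [NormedSpace ℝ E] {f : (ι → ℝ) → E} (hf : Integrable f) :
    HasSum (fun v : ι → ℤ ↦ ∫ x in {x : ι → ℝ | ∀ i, x i ∈ Ioc (0 : ℝ) (0 + 1)},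
      f (x + fun i ↦ (v i : ℝ))) (∫ x, f x) := by
  set S := {x : ι → ℝ | ∀ i, x i ∈ Ioc (0 : ℝ) (0 + 1)}
  have hS : MeasurableSet S := by
    simp only [S, ofPred_forall]
    exact .iInter fun i ↦ measurableSet_Ioc.preimage (measurable_pi_apply i)
  let s (v : ι → ℤ) : Set (ι → ℝ) := (· - fun i ↦ (v i : ℝ)) ⁻¹' S
  have hmem {v : ι → ℤ} {x} : x ∈ s v ↔ ∀ i, ⌈x i⌉ - 1 = v i := by
    refine forall_congr' fun i ↦ ?_
    rw [sub_eq_iff_eq_add, Int.ceil_eq_iff]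
    simp only [Pi.sub_apply, mem_Ioc, sub_pos, Int.cast_add, Int.cast_one]
    constructor <;> rintro ⟨h, h'⟩ <;> constructor <;> linarith
  have hU : ⋃ v, s v = univ := eq_univ_of_forall fun x ↦
    mem_iUnion.mpr ⟨fun i ↦ ⌈x i⌉ - 1, hmem.mpr fun i ↦ rfl⟩
  have hd : Pairwise (Function.onFun Disjoint s) := fun v w hvw ↦
    disjoint_left.mpr fun x hv hw ↦ hvw <| funext fun i ↦ (hmem.mp hv i).symm.trans (hmem.mp hw i)
  rw [← setIntegral_univ, ← hU]
  convert! hasSum_integral_iUnion (fun v ↦ hS.preimage (by fun_prop)) hd hf.integrableOn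
    using 2 with v
  have := (measurePreserving_sub_right (volume : Measure (ι → ℝ))
    (fun i ↦ (v i : ℝ))).setIntegral_preimage_emb
    (MeasurableEquiv.subRight _).measurableEmbedding (fun x ↦ f (x + fun i ↦ (v i : ℝ))) S
  simpa using this.symm

theorem mFourierCoeff_of_hasSum {ι : Type*} [Fintype ι] {f : (ι → ℝ) → ℂ} (hf : Integrable f)
    {F : UnitAddTorus ι → ℂ} (hF : ∀ x : ι → ℝ,
      HasSum (fun v : ι → ℤ ↦ f (x + fun i ↦ (v i : ℝ))) (F fun i ↦ (x i : UnitAddCircle)))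
    (n : ι → ℤ) :
    UnitAddTorus.mFourierCoeff F n =
      ∫ x : ι → ℝ, UnitAddTorus.mFourier (-n) (fun i ↦ (x i : UnitAddCircle)) * f x := by
  have he : Continuous fun x : ι → ℝ ↦
      UnitAddTorus.mFourier (-n) (fun i ↦ (x i : UnitAddCircle)) := by
    refine (map_continuous _).comp (continuous_pi fun i ↦ ?_)
    exact (AddCircle.continuous_mk' 1).comp (continuous_apply i)
  have hnorm (x : UnitAddTorus ι) : ‖UnitAddTorus.mFourier (-n) x‖ = 1 := by
    simp only [UnitAddTorus.mFourier, ContinuousMap.coe_mk, norm_prod, fourier_apply,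
      Circle.norm_coe, Finset.prod_const_one]
  have hint : Integrable fun x : ι → ℝ ↦
      UnitAddTorus.mFourier (-n) (fun i ↦ (x i : UnitAddCircle)) * f x :=
    hf.bdd_mul (c := 1) he.aestronglyMeasurable (.of_forall fun x ↦ (hnorm _).le)
  rw [UnitAddTorus.mFourierCoeff_eq_integral _ _ 0, ← (hasSum_setIntegral_unit_cube hint).tsum_eq]
  have htrans (v : ι → ℤ) : MeasurePreserving (fun x : ι → ℝ ↦ x + fun i ↦ (v i : ℝ)) :=
    measurePreserving_add_right _ _
  simp only [Pi.zero_apply]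
  refine .trans ?_ (integral_tsum_of_summable_integral_norm ?_ ?_).symm
  · refine integral_congr_ae (.of_forall fun x ↦ ?_)
    simp only [Pi.add_apply, AddCircle.coe_add]
    simp only [← (hF x).tsum_eq, smul_eq_mul, ← tsum_mul_left]
    have h0 (m : ℤ) : ((m : ℝ) : UnitAddCircle) = 0 := by
      simp
    simp [h0]
  · exact fun v ↦ ((htrans v).integrable_comp_of_integrable hint).integrableOn
  · exact (hasSum_setIntegral_unit_cube hint.norm).summable

/-- **Poisson's summation formula** in several variables. -/
theorem tsum_eq_tsum_mFourier_integral {ι : Type*} [Fintype ι] {f : C(ι → ℝ, ℂ)}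
    (hint : Integrable f)
    (hf : ∀ K : Compacts (ι → ℝ), Summable fun v : ι → ℤ ↦
      ‖(f.comp (ContinuousMap.addRight fun i ↦ (v i : ℝ))).restrict K‖)
    (hsum : Summable fun n : ι → ℤ ↦
      ∫ x : ι → ℝ, UnitAddTorus.mFourier (-n) (fun i ↦ (x i : UnitAddCircle)) * f x) :
    ∑' v : ι → ℤ, f (fun i ↦ (v i : ℝ)) = ∑' n : ι → ℤ,
      ∫ x : ι → ℝ, UnitAddTorus.mFourier (-n) (fun i ↦ (x i : UnitAddCircle)) * f x := by
  obtain ⟨F, hF⟩ := exists_torus_periodization f hf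
  simp only [← mFourierCoeff_of_hasSum hint hF] at hsum ⊢
  have := UnitAddTorus.hasSum_mFourier_series_apply_of_summable hsum 0
  have h0 := hF 0
  simp only [zero_add, Pi.zero_apply, AddCircle.coe_zero] at h0
  rw [h0.tsum_eq]
  convert! this.tsum_eq.symm using 3 with n
  simp [UnitAddTorus.mFourier]

/-- A Gaussian is summable over the integer points. -/
theorem summable_exp_neg_mul_norm_sq {ι : Type*} [Fintype ι] {c : ℝ} (hc : 0 < c) :
    Summable fun v : ι → ℤ ↦ Real.exp (-c * ‖fun i ↦ (v i : ℝ)‖ ^ 2) := by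
  let b := Pi.basisFun ℝ ι
  let e : Submodule.span ℤ (Set.range b) ≃ (ι → ℤ) := (b.restrictScalars ℤ).equivFun.toEquiv
  have he (v : ι → ℤ) : ((e.symm v : Submodule.span ℤ (Set.range b)) : ι → ℝ) =
      fun i ↦ (v i : ℝ) := by
    classical
    ext i
    simp [e, b, Module.Basis.equivFun_symm_apply, Module.Basis.restrictScalars_apply,
      Pi.basisFun_apply, Pi.single_apply]
  have h1 := ZLattice.summable_norm_pow_inv (Submodule.span ℤ (Set.range b))
    (2 * (Module.finrank ℤ (Submodule.span ℤ (Set.range b)) + 1)) (by omega)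
  rw [← e.symm.summable_iff] at h1
  set k := Module.finrank ℤ (Submodule.span ℤ (Set.range b)) + 1
  refine .of_norm_bounded_eventually (h1.mul_left ((k.factorial : ℝ) * c⁻¹ ^ k)) ?_
  filter_upwards [(Set.finite_singleton (0 : ι → ℤ)).compl_mem_cofinite] with v hv
  have hnorm : ‖e.symm v‖ = ‖fun i ↦ (v i : ℝ)‖ := by rw [← he]; rfl
  have hpos : 0 < ‖fun i ↦ (v i : ℝ)‖ :=
    norm_pos_iff.mpr fun h ↦ hv (funext fun i ↦ by simpa using congrFun h i)
  simp only [Function.comp_apply, hnorm]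
  set r := ‖fun i ↦ (v i : ℝ)‖
  have h2 := Real.pow_div_factorial_le_exp (c * r ^ 2) (by positivity) k
  rw [Real.norm_eq_abs, Real.abs_exp, neg_mul, Real.exp_neg]
  calc (Real.exp (c * r ^ 2))⁻¹ ≤ ((c * r ^ 2) ^ k / k.factorial)⁻¹ :=
        inv_anti₀ (by positivity) h2
    _ = _ := by
      rw [inv_div, mul_pow, inv_pow, inv_pow, ← pow_mul, div_eq_mul_inv, mul_inv, mul_assoc]

theorem exists_pos_mul_norm_sq_le {ι : Type*} [Fintype ι] [DecidableEq ι] {A : Matrix ι ι ℝ}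
    (hA : IsUnit A.det) :
    ∃ c > 0, ∀ x : ι → ℝ, c * ‖x‖ ^ 2 ≤ ‖WithLp.toLp 2 (A *ᵥ x)‖ ^ 2 := by
  let T : EuclideanSpace ℝ ι →L[ℝ] (ι → ℝ) := LinearMap.toContinuousLinearMap
    (A⁻¹.mulVecLin ∘ₗ (WithLp.linearEquiv 2 ℝ (ι → ℝ)).toLinearMap)
  have hT (x : ι → ℝ) : T (WithLp.toLp 2 (A *ᵥ x)) = x := by
    simp [T, Matrix.mulVec_mulVec, Matrix.nonsing_inv_mul _ hA]
  refine ⟨((‖T‖ + 1) ^ 2)⁻¹, by positivity, fun x ↦ ?_⟩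
  rw [inv_mul_le_iff₀ (by positivity), ← mul_pow]
  gcongr
  calc ‖x‖ = ‖T (WithLp.toLp 2 (A *ᵥ x))‖ := by rw [hT]
    _ ≤ ‖T‖ * ‖WithLp.toLp 2 (A *ᵥ x)‖ := T.le_opNorm _
    _ ≤ _ := by gcongr; linarith

theorem measurePreserving_toLp_mulVec {ι : Type*} [Fintype ι] [DecidableEq ι]
    {A : Matrix ι ι ℝ} (hA : |A.det| = 1) :
    MeasurePreserving (fun x : ι → ℝ ↦ WithLp.toLp 2 (A *ᵥ x)) := by
  have hdet : A.det ≠ 0 := fun h ↦ by simp [h] at hA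
  have hmp : MeasurePreserving (Matrix.toLin' A) (volume : Measure (ι → ℝ)) volume := by
    refine ⟨(LinearMap.continuous_on_pi _).measurable, ?_⟩
    rw [Real.map_matrix_volume_pi_eq_smul_volume_pi hdet, abs_inv, hA]
    simp
  exact (PiLp.volume_preserving_toLp ι).comp hmp

theorem measurableEmbedding_toLp_mulVec {ι : Type*} [Fintype ι] [DecidableEq ι]
    {A : Matrix ι ι ℝ} (hA : IsUnit A.det) :
    MeasurableEmbedding (fun x : ι → ℝ ↦ WithLp.toLp 2 (A *ᵥ x)) := by
  refine (MeasurableEquiv.toLp 2 _).measurableEmbedding.comp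
    ((LinearMap.continuous_on_pi (Matrix.toLin' A)).measurableEmbedding ?_)
  exact Matrix.mulVec_injective_iff_isUnit.mpr ((Matrix.isUnit_iff_isUnit_det A).mpr hA)

theorem mFourier_mul_gaussian {ι : Type*} [Fintype ι] [DecidableEq ι] {A : Matrix ι ι ℝ}
    (hA : IsUnit A.det) (b : ℂ) (n : ι → ℤ) (x : ι → ℝ) :
    UnitAddTorus.mFourier (-n) (fun i ↦ (x i : UnitAddCircle)) *
      Complex.exp (-b * ‖WithLp.toLp 2 (A *ᵥ x)‖ ^ 2) =
    Complex.exp (-b * ‖WithLp.toLp 2 (A *ᵥ x)‖ ^ 2 + (-2 * Real.pi * Complex.I) *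
      inner ℝ (WithLp.toLp 2 (Aᵀ⁻¹ *ᵥ fun i ↦ (n i : ℝ))) (WithLp.toLp 2 (A *ᵥ x))) := by
  have h : inner ℝ (WithLp.toLp 2 (Aᵀ⁻¹ *ᵥ fun i ↦ (n i : ℝ))) (WithLp.toLp 2 (A *ᵥ x)) =
      ∑ i, n i * x i := by
    rw [EuclideanSpace.inner_toLp_toLp, star_trivial, dotProduct_comm,
      ← Matrix.vecMul_transpose, Matrix.transpose_nonsing_inv, Matrix.transpose_transpose,
      ← Matrix.dotProduct_mulVec, Matrix.mulVec_mulVec, Matrix.nonsing_inv_mul _ hA,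
      Matrix.one_mulVec, dotProduct]
  rw [h, add_comm, Complex.exp_add]
  congr 1
  simp only [UnitAddTorus.mFourier, ContinuousMap.coe_mk, fourier_coe_apply, ← Complex.exp_sum]
  congr 1
  push_cast
  rw [Finset.mul_sum]
  refine Finset.sum_congr rfl fun i _ ↦ ?_
  simp
  ring

theorem summable_norm_restrict_gaussian {ι : Type*} [Fintype ι] [DecidableEq ι]
    {A : Matrix ι ι ℝ} (hA : IsUnit A.det) {b : ℂ} (hb : 0 < b.re) {f : C(ι → ℝ, ℂ)}
    (hf : ∀ x, f x = Complex.exp (-b * ‖WithLp.toLp 2 (A *ᵥ x)‖ ^ 2)) (K : Compacts (ι → ℝ)) :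
    Summable fun v : ι → ℤ ↦
      ‖(f.comp (ContinuousMap.addRight fun i ↦ (v i : ℝ))).restrict K‖ := by
  obtain ⟨c, hc, hcA⟩ := exists_pos_mul_norm_sq_le hA
  obtain ⟨R, hR⟩ := K.isCompact.isBounded.exists_norm_le
  refine .of_nonneg_of_le (fun _ ↦ norm_nonneg _) (fun v ↦ ?_)
    ((summable_exp_neg_mul_norm_sq (ι := ι) (c := b.re * c / 2) (by positivity)).mul_left
      (Real.exp (b.re * c * R ^ 2)))
  rw [ContinuousMap.norm_le _ (by positivity)]
  rintro ⟨x, hx⟩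
  have hx := hR x hx
  simp only [ContinuousMap.restrict_apply, ContinuousMap.comp_apply, ContinuousMap.coe_addRight,
    hf, Complex.norm_exp, ← Real.exp_add]
  gcongr
  set v' : ι → ℝ := fun i ↦ (v i : ℝ)
  have h1 : ‖v'‖ ≤ ‖x + v'‖ + ‖x‖ := by simpa using norm_sub_le (x + v') x
  have h2 : ‖v'‖ ^ 2 ≤ 2 * ‖x + v'‖ ^ 2 + 2 * R ^ 2 := by
    nlinarith [norm_nonneg v', norm_nonneg x, sq_nonneg (‖x + v'‖ - ‖x‖)]
  have h3 : (-b * (‖WithLp.toLp 2 (A *ᵥ (x + v'))‖ : ℂ) ^ 2).re =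
      -b.re * ‖WithLp.toLp 2 (A *ᵥ (x + v'))‖ ^ 2 := by
    rw [← Complex.ofReal_pow, Complex.re_mul_ofReal, Complex.neg_re]
  rw [h3]
  nlinarith [mul_le_mul_of_nonneg_left (hcA (x + v')) hb.le, mul_le_mul_of_nonneg_left h2
    (mul_pos hb hc).le]

theorem summable_cexp_neg_mul_norm_sq_mulVec {ι : Type*} [Fintype ι] [DecidableEq ι]
    {A : Matrix ι ι ℝ} (hA : IsUnit A.det) {b : ℂ} (hb : 0 < b.re) :
    Summable fun v : ι → ℤ ↦
      Complex.exp (-b * ‖WithLp.toLp 2 (A *ᵥ fun i ↦ (v i : ℝ))‖ ^ 2) := by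
  obtain ⟨c, hc, hcA⟩ := exists_pos_mul_norm_sq_le hA
  refine .of_norm_bounded (summable_exp_neg_mul_norm_sq (ι := ι) (mul_pos hb hc)) fun v ↦ ?_
  rw [Complex.norm_exp, ← Complex.ofReal_pow, Complex.re_mul_ofReal, Complex.neg_re]
  refine Real.exp_le_exp.mpr ?_
  have := mul_le_mul_of_nonneg_left (hcA fun i ↦ (v i : ℝ)) hb.le
  linarith

/-- The **theta transformation formula** for the lattice spanned by the columns of a matrix of
determinant `±1`. -/
theorem tsum_cexp_neg_mul_norm_sq_mulVec {ι : Type*} [Fintype ι] [DecidableEq ι]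
    {A : Matrix ι ι ℝ} (hA : |A.det| = 1) {b : ℂ} (hb : 0 < b.re) :
    ∑' v : ι → ℤ, Complex.exp (-b * ‖WithLp.toLp 2 (A *ᵥ fun i ↦ (v i : ℝ))‖ ^ 2) =
      (Real.pi / b) ^ (Fintype.card ι / 2 : ℂ) * ∑' n : ι → ℤ, Complex.exp
        (-(Real.pi ^ 2 / b) * ‖WithLp.toLp 2 (Aᵀ⁻¹ *ᵥ fun i ↦ (n i : ℝ))‖ ^ 2) := by
  have hdet : IsUnit A.det := isUnit_iff_ne_zero.mpr fun h ↦ by simp [h] at hA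
  have hdet' : IsUnit (Aᵀ⁻¹).det := by simpa using hdet
  have hb' : 0 < (Real.pi ^ 2 / b : ℂ).re := by
    rw [← Complex.ofReal_pow, Complex.div_re]
    have : b ≠ 0 := fun h ↦ by simp [h] at hb
    simp only [Complex.ofReal_re, Complex.ofReal_im, zero_mul, zero_div, add_zero]
    have := Complex.normSq_pos.mpr this
    positivity
  let f : C(ι → ℝ, ℂ) :=
    ⟨fun x ↦ Complex.exp (-b * ‖WithLp.toLp 2 (A *ᵥ x)‖ ^ 2), by fun_prop⟩
  have hcoeff (n : ι → ℤ) :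
      ∫ x : ι → ℝ, UnitAddTorus.mFourier (-n) (fun i ↦ (x i : UnitAddCircle)) * f x =
      (Real.pi / b) ^ (Fintype.card ι / 2 : ℂ) * Complex.exp
        (-(Real.pi ^ 2 / b) * ‖WithLp.toLp 2 (Aᵀ⁻¹ *ᵥ fun i ↦ (n i : ℝ))‖ ^ 2) := by
    simp only [f, ContinuousMap.coe_mk, mFourier_mul_gaussian hdet]
    rw [(measurePreserving_toLp_mulVec hA).integral_comp (measurableEmbedding_toLp_mulVec hdet)
      (fun y ↦ Complex.exp (-b * ‖y‖ ^ 2 + (-2 * Real.pi * Complex.I) *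
        inner ℝ (WithLp.toLp 2 (Aᵀ⁻¹ *ᵥ fun i ↦ (n i : ℝ))) y)),
      GaussianFourier.integral_cexp_neg_mul_sq_norm_add_of_euclideanSpace hb]
    congr 2
    ring_nf
    simp only [Complex.I_sq]
    ring
  have hint : Integrable f := by
    have := (measurePreserving_toLp_mulVec hA).integrable_comp_emb
      (measurableEmbedding_toLp_mulVec hdet) |>.mpr
      (GaussianFourier.integrable_cexp_neg_mul_sq_norm_add_of_euclideanSpace hb 0
        (0 : EuclideanSpace ℝ ι))
    simpa [Function.comp_def, f] using this
  have key := tsum_eq_tsum_mFourier_integral hint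
    (summable_norm_restrict_gaussian hdet hb fun x ↦ rfl)
    (by simpa only [hcoeff] using (summable_cexp_neg_mul_norm_sq_mulVec hdet' hb').mul_left _)
  simp only [hcoeff, tsum_mul_left] at key
  exact key

end PoissonSummation

section GramMatrix

open Filter Topology in
theorem tendsto_intFloor_mul_div_atTop (a : ℝ) :
    Tendsto (fun t : ℝ ↦ (⌊a * t⌋ : ℝ) / t) atTop (𝓝 a) := by
  refine tendsto_of_tendsto_of_tendsto_of_le_of_le' (g := fun t ↦ a - t⁻¹) (h := fun _ ↦ a)
    ?_ tendsto_const_nhds ?_ ?_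
  · simpa using (tendsto_const_nhds (x := a)).sub (tendsto_inv_atTop_zero (𝕜 := ℝ))
  · filter_upwards [eventually_gt_atTop 0] with t ht
    rw [le_div_iff₀ ht, sub_mul, inv_mul_cancel₀ ht.ne']
    exact (Int.sub_one_lt_floor _).le
  · filter_upwards [eventually_gt_atTop 0] with t ht
    rw [div_le_iff₀ ht]
    exact Int.floor_le _

open Filter Topology in
/-- A symmetric integer matrix whose quadratic form is nonnegative on integer vectors is a real
Gram matrix. -/
theorem Matrix.exists_transpose_mul_self_eq_map_intCast {ι : Type*} [Fintype ι] [DecidableEq ι]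
    {G : Matrix ι ι ℤ} (hG : G.IsSymm) (hpos : ∀ v, 0 ≤ v ⬝ᵥ G *ᵥ v) :
    ∃ A : Matrix ι ι ℝ, Aᵀ * A = G.map (Int.cast : ℤ → ℝ) := by
  have hsemi : (G.map (Int.cast : ℤ → ℝ)).PosSemidef := by
    refine .of_dotProduct_mulVec_nonneg ?_ fun x ↦ ?_
    · rw [IsHermitian, conjTranspose_eq_transpose_of_trivial]
      exact hG.map _
    · have hlim : Tendsto (fun (t : ℝ) (i : ι) ↦ (⌊x i * t⌋ : ℝ) / t) atTop (𝓝 x) :=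
        tendsto_pi_nhds.mpr fun i ↦ tendsto_intFloor_mul_div_atTop (x i)
      have hcont : Continuous fun x : ι → ℝ ↦ star x ⬝ᵥ (G.map (Int.cast : ℤ → ℝ) *ᵥ x) := by
        fun_prop
      refine ge_of_tendsto' ((hcont.tendsto x).comp hlim) fun t ↦ ?_
      have h1 : (fun i : ι ↦ (⌊x i * t⌋ : ℝ) / t) = t⁻¹ • fun i ↦ (⌊x i * t⌋ : ℝ) := by
        ext i
        simp [div_eq_inv_mul]
      have h2 := hpos fun i ↦ ⌊x i * t⌋
      have h3 : (0 : ℝ) ≤ (fun i ↦ (⌊x i * t⌋ : ℝ)) ⬝ᵥ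
          (G.map (Int.cast : ℤ → ℝ) *ᵥ fun i ↦ (⌊x i * t⌋ : ℝ)) := by
        have := Int.cast_nonneg (R := ℝ) h2
        simpa [dotProduct, mulVec] using this
      simp only [Function.comp_apply, h1, star_trivial, mulVec_smul, dotProduct_smul,
        smul_dotProduct, smul_eq_mul]
      rw [← mul_assoc]
      exact mul_nonneg (mul_self_nonneg _) h3
  open scoped MatrixOrder Matrix.Norms.L2Operator in
  obtain ⟨A, hA⟩ := CStarAlgebra.nonneg_iff_eq_star_mul_self.mp hsemi.nonneg
  exact ⟨A, by rw [hA, star_eq_conjTranspose, conjTranspose_eq_transpose_of_trivial]⟩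

theorem Matrix.norm_sq_toLp_mulVec {ι : Type*} [Fintype ι] (A : Matrix ι ι ℝ) (x : ι → ℝ) :
    ‖WithLp.toLp 2 (A *ᵥ x)‖ ^ 2 = x ⬝ᵥ (Aᵀ * A) *ᵥ x := by
  rw [← real_inner_self_eq_norm_sq, EuclideanSpace.inner_toLp_toLp, star_trivial,
    ← mulVec_mulVec, dotProduct_mulVec x, vecMul_transpose]

/-- The bijection of the integer lattice induced by a unimodular matrix. -/
noncomputable def Matrix.mulVecEquiv {ι : Type*} [Fintype ι] [DecidableEq ι] {G : Matrix ι ι ℤ}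
    (hG : IsUnit G.det) : (ι → ℤ) ≃ (ι → ℤ) where
  toFun v := G *ᵥ v
  invFun v := G⁻¹ *ᵥ v
  left_inv v := by simp [mulVec_mulVec, nonsing_inv_mul _ hG]
  right_inv v := by simp [mulVec_mulVec, mul_nonsing_inv _ hG]

theorem Matrix.cast_dotProduct_mulVec {ι : Type*} [Fintype ι] (G : Matrix ι ι ℤ) (v : ι → ℤ) :
    ((v ⬝ᵥ G *ᵥ v : ℤ) : ℝ) =
      (fun i ↦ (v i : ℝ)) ⬝ᵥ G.map (Int.cast : ℤ → ℝ) *ᵥ fun i ↦ (v i : ℝ) := by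
  simp [dotProduct, mulVec]

theorem Matrix.isUnit_det_of_transpose_mul_self {ι : Type*} [Fintype ι] [DecidableEq ι]
    {G : Matrix ι ι ℤ} (hunit : IsUnit G.det) {A : Matrix ι ι ℝ}
    (hA : Aᵀ * A = G.map (Int.cast : ℤ → ℝ)) : |A.det| = 1 := by
  have h : A.det ^ 2 = (G.det : ℝ) := by
    have := congrArg Matrix.det hA
    rw [det_mul, det_transpose] at this
    rw [sq, this]
    exact (Int.cast_det G).symm
  rcases Int.isUnit_iff.mp hunit with h1 | h1 <;> rw [h1] at h <;> push_cast at h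
  · exact (sq_eq_sq₀ (abs_nonneg _) zero_le_one).mp (by rw [sq_abs, h, one_pow])
  · nlinarith [sq_nonneg A.det]

theorem summable_cexp_neg_mul_unimodular {ι : Type*} [Fintype ι] [DecidableEq ι]
    {G : Matrix ι ι ℤ} (hG : G.IsSymm) (hpos : ∀ v, 0 ≤ v ⬝ᵥ G *ᵥ v) (hunit : IsUnit G.det)
    {b : ℂ} (hb : 0 < b.re) :
    Summable fun v : ι → ℤ ↦ Complex.exp (-b * (v ⬝ᵥ G *ᵥ v : ℤ)) := by
  obtain ⟨A, hA⟩ := Matrix.exists_transpose_mul_self_eq_map_intCast hG hpos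
  have hdet := Matrix.isUnit_det_of_transpose_mul_self hunit hA
  refine (summable_cexp_neg_mul_norm_sq_mulVec (A := A)
    (isUnit_iff_ne_zero.mpr fun h ↦ by simp [h] at hdet) hb).congr fun v ↦ ?_
  rw [← Complex.ofReal_pow, Matrix.norm_sq_toLp_mulVec, hA, ← Matrix.cast_dotProduct_mulVec,
    Complex.ofReal_intCast]

theorem tsum_cexp_neg_mul_unimodular {ι : Type*} [Fintype ι] [DecidableEq ι]
    {G : Matrix ι ι ℤ} (hG : G.IsSymm) (hpos : ∀ v, 0 ≤ v ⬝ᵥ G *ᵥ v) (hunit : IsUnit G.det)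
    {b : ℂ} (hb : 0 < b.re) :
    ∑' v : ι → ℤ, Complex.exp (-b * (v ⬝ᵥ G *ᵥ v : ℤ)) =
      (Real.pi / b) ^ (Fintype.card ι / 2 : ℂ) *
        ∑' v : ι → ℤ, Complex.exp (-(Real.pi ^ 2 / b) * (v ⬝ᵥ G *ᵥ v : ℤ)) := by
  obtain ⟨A, hA⟩ := Matrix.exists_transpose_mul_self_eq_map_intCast hG hpos
  have hdet := Matrix.isUnit_det_of_transpose_mul_self hunit hA
  have hQ (v : ι → ℤ) : ((v ⬝ᵥ G *ᵥ v : ℤ) : ℂ) =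
      (‖WithLp.toLp 2 (A *ᵥ fun i ↦ (v i : ℝ))‖ : ℂ) ^ 2 := by
    rw [← Complex.ofReal_pow, Matrix.norm_sq_toLp_mulVec, hA, ← Matrix.cast_dotProduct_mulVec,
      Complex.ofReal_intCast]
  simp only [hQ]
  rw [tsum_cexp_neg_mul_norm_sq_mulVec hdet hb, ← (Matrix.mulVecEquiv hunit).tsum_eq]
  have hdual (v : ι → ℤ) : Aᵀ⁻¹ *ᵥ (fun i ↦ (Matrix.mulVecEquiv hunit v i : ℝ)) =
      A *ᵥ fun i ↦ (v i : ℝ) := by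
    have h1 : (fun i ↦ (Matrix.mulVecEquiv hunit v i : ℝ)) =
        G.map (Int.cast : ℤ → ℝ) *ᵥ fun i ↦ (v i : ℝ) := by
      ext i
      simp [Matrix.mulVecEquiv, Matrix.mulVec, dotProduct]
    have h2 : IsUnit Aᵀ.det := by
      rw [Matrix.det_transpose]
      exact isUnit_iff_ne_zero.mpr fun h ↦ by simp [h] at hdet
    rw [h1, ← hA, Matrix.mulVec_mulVec, ← mul_assoc, Matrix.nonsing_inv_mul _ h2, one_mul]
  simp only [hdual]

end GramMatrix

/-- The theta series of an integral quadratic form. -/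
noncomputable def latticeTheta {ι : Type*} [Fintype ι] (G : Matrix ι ι ℤ) (τ : ℂ) : ℂ :=
  ∑' v : ι → ℤ, Complex.exp (Real.pi * Complex.I * τ * (v ⬝ᵥ G *ᵥ v : ℤ))

section latticeTheta

open UpperHalfPlane hiding I
open Complex
open scoped MatrixGroups ModularForm

variable {ι : Type*} [Fintype ι] [DecidableEq ι] {G : Matrix ι ι ℤ}

theorem summable_latticeTheta (hG : G.IsSymm) (hpos : ∀ v, 0 ≤ v ⬝ᵥ G *ᵥ v)
    (hunit : IsUnit G.det) {τ : ℂ} (hτ : 0 < τ.im) :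
    Summable fun v : ι → ℤ ↦ cexp (Real.pi * I * τ * (v ⬝ᵥ G *ᵥ v : ℤ)) := by
  simpa using summable_cexp_neg_mul_unimodular hG hpos hunit (b := -(Real.pi * I * τ))
    (by simpa using mul_pos Real.pi_pos hτ)

theorem latticeTheta_neg_inv (hG : G.IsSymm) (hpos : ∀ v, 0 ≤ v ⬝ᵥ G *ᵥ v)
    (hunit : IsUnit G.det) (hcard : Fintype.card ι = 24) {τ : ℂ} (hτ : 0 < τ.im) :
    latticeTheta G (-τ)⁻¹ = τ ^ 12 * latticeTheta G τ := by
  have h0 : τ ≠ 0 := fun h ↦ by simp [h] at hτ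
  have hpi : (Real.pi : ℂ) ≠ 0 := by simp
  have key := tsum_cexp_neg_mul_unimodular hG hpos hunit (b := -(Real.pi * I * τ))
    (by simpa using mul_pos Real.pi_pos hτ)
  have hpow : (Real.pi / -(Real.pi * I * τ) : ℂ) ^ ((Fintype.card ι : ℂ) / 2) = (τ ^ 12)⁻¹ := by
    rw [hcard, show ((24 : ℕ) : ℂ) / 2 = ((12 : ℕ) : ℂ) by norm_num, cpow_natCast,
      show (Real.pi / -(Real.pi * I * τ) : ℂ) = I / τ by field_simp; simp, div_pow,
      show I ^ 12 = 1 by rw [show 12 = 4 * 3 by norm_num, pow_mul, I_pow_four, one_pow], one_div]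
  have hdual : -(Real.pi ^ 2 / -(Real.pi * I * τ)) = Real.pi * I * (-τ)⁻¹ := by
    field_simp
    simp
  rw [hpow, hdual, neg_neg] at key
  rw [latticeTheta, latticeTheta, key, mul_inv_cancel_left₀ (pow_ne_zero _ h0)]

theorem differentiableOn_latticeTheta (hG : G.IsSymm) (hpos : ∀ v, 0 ≤ v ⬝ᵥ G *ᵥ v)
    (hunit : IsUnit G.det) : DifferentiableOn ℂ (latticeTheta G) {τ | 0 < τ.im} := by
  intro τ hτ
  obtain ⟨δ, hδ, hδτ⟩ := exists_between (Set.mem_ofPred.mp hτ)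
  have hopen : IsOpen {z : ℂ | δ < z.im} := isOpen_lt continuous_const continuous_im
  refine DifferentiableAt.differentiableWithinAt ?_
  refine DifferentiableOn.differentiableAt (s := {z : ℂ | δ < z.im}) ?_ (hopen.mem_nhds hδτ)
  refine differentiableOn_tsum_of_summable_norm
    (summable_latticeTheta hG hpos hunit (τ := δ * I) (by simpa using hδ)).norm
    (fun v ↦ by fun_prop) hopen fun v z hz ↦ ?_
  have hre (w : ℂ) : (Real.pi * I * w * (v ⬝ᵥ G *ᵥ v : ℤ)).re =
      -(Real.pi * (v ⬝ᵥ G *ᵥ v : ℤ)) * w.im := by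
    simp
    ring
  rw [norm_exp, norm_exp, Real.exp_le_exp, hre, hre]
  have h1 : (0 : ℝ) ≤ (v ⬝ᵥ G *ᵥ v : ℤ) := Int.cast_nonneg (hpos v)
  have h2 : δ ≤ z.im := (Set.mem_ofPred.mp hz).le
  simp only [mul_I_im, ofReal_re]
  exact mul_le_mul_of_nonpos_left h2 (neg_nonpos.mpr (mul_nonneg Real.pi_pos.le h1))

theorem hasSum_latticeTheta (hG : G.IsSymm) (hpos : ∀ v, 0 ≤ v ⬝ᵥ G *ᵥ v)
    (hunit : IsUnit G.det) (heven : ∀ v, Even (v ⬝ᵥ G *ᵥ v)) {τ : ℂ} (hτ : 0 < τ.im) :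
    HasSum (fun m : ℕ ↦ (Nat.card {v : ι → ℤ | v ⬝ᵥ G *ᵥ v = 2 * m} : ℂ) •
      Function.Periodic.qParam 1 τ ^ m) (latticeTheta G τ) := by
  let N (v : ι → ℤ) : ℕ := (v ⬝ᵥ G *ᵥ v).toNat / 2
  have hN (v : ι → ℤ) (m : ℕ) : N v = m ↔ v ⬝ᵥ G *ᵥ v = 2 * m := by
    obtain ⟨k, hk⟩ := heven v
    have := hpos v
    simp only [N]
    lia
  have hq (v : ι → ℤ) (m : ℕ) (h : N v = m) :
      cexp (Real.pi * I * τ * (v ⬝ᵥ G *ᵥ v : ℤ)) = Function.Periodic.qParam 1 τ ^ m := by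
    rw [(hN v m).mp h, Function.Periodic.qParam, ← exp_nat_mul]
    congr 1
    push_cast
    ring
  convert! (summable_latticeTheta hG hpos hunit hτ).hasSum.tsum_fiberwise N using 2 with m
  have hset : {v | v ⬝ᵥ G *ᵥ v = 2 * (m : ℤ)} = N ⁻¹' {m} := Set.ext fun v ↦ (hN v m).symm
  rw [tsum_congr fun v : ↑(N ⁻¹' {m}) ↦ hq v m v.2, tsum_const, nsmul_eq_mul, smul_eq_mul, hset]

/-- The theta series of an even unimodular lattice of rank 24, as a modular form. -/
theorem exists_modularForm_eq_latticeTheta (hG : G.IsSymm) (hpos : ∀ v, 0 ≤ v ⬝ᵥ G *ᵥ v)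
    (hunit : IsUnit G.det) (heven : ∀ v, Even (v ⬝ᵥ G *ᵥ v)) (hcard : Fintype.card ι = 24) :
    ∃ f : ModularForm 𝒮ℒ 12, ∀ τ : ℍ, f τ = latticeTheta G τ := by
  set θ : ℍ → ℂ := fun τ ↦ latticeTheta G τ
  have hS : θ ∣[(12 : ℤ)] ModularGroup.S = θ := by
    ext τ
    rw [ModularForm.SL_slash_apply, modular_S_smul, ModularGroup.denom_S]
    change latticeTheta G (-τ)⁻¹ * _ = latticeTheta G τ
    rw [latticeTheta_neg_inv hG hpos hunit hcard τ.im_pos, zpow_neg, mul_comm]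
    exact inv_mul_cancel_left₀ (pow_ne_zero 12 τ.ne_zero) _
  have hsum (τ : ℍ) := hasSum_latticeTheta hG hpos hunit heven τ.im_pos
  have hT : θ ∣[(12 : ℤ)] ModularGroup.T = θ := by
    ext τ
    have hden : denom (Matrix.SpecialLinearGroup.toGL
        ((Matrix.SpecialLinearGroup.map (Int.castRingHom ℝ)) ModularGroup.T)) (τ : ℂ) = 1 := by
      rw [ModularGroup.denom_apply, ModularGroup.coe_T]
      simp
    rw [ModularForm.SL_slash_apply, modular_T_smul, hden, one_zpow, mul_one]
    refine (hsum _).unique ?_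
    have hper : Function.Periodic.qParam 1 ((((1 : ℝ) +ᵥ τ : ℍ)) : ℂ) =
        Function.Periodic.qParam 1 τ := by
      rw [coe_vadd, Function.Periodic.qParam, Function.Periodic.qParam, ofReal_one, div_one,
        div_one, mul_add, exp_add, mul_one, exp_two_pi_mul_I, one_mul]
    simpa only [hper] using hsum τ
  refine ⟨{ toFun := θ, slash_action_eq' := ?_, holo' := ?_, bdd_at_cusps' := ?_ }, fun _ ↦ rfl⟩
  · rintro _ ⟨A, rfl⟩
    exact SlashInvariantForm.slash_action_generators_SL2Z hS hT A
  · rw [UpperHalfPlane.mdifferentiable_iff]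
    refine (differentiableOn_latticeTheta hG hpos hunit).congr fun z hz ↦ ?_
    simp [θ, ofComplex_apply_of_im_pos hz]
  · intro c hc
    rw [Subgroup.IsArithmetic.isCusp_iff_isCusp_SL2Z] at hc
    rw [OnePoint.isBoundedAt_iff_forall_SL2Z hc]
    intro γ _
    rw [SlashInvariantForm.slash_action_generators_SL2Z hS hT]
    exact isBoundedAtImInfty_of_hasSum_qExpansion one_pos hsum

end latticeTheta

section WeightTwelve

open UpperHalfPlane ModularForm ModularFormClass EisensteinSeries
open scoped MatrixGroups ModularForm

theorem qExpansion_E₄_coeff (m : ℕ) : (qExpansion 1 E₄).coeff m =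
    if m = 0 then 1 else 240 * (ArithmeticFunction.sigma 3 m : ℂ) := by
  rw [E_qExpansion_coeff _ ⟨2, rfl⟩, show bernoulli 4 = -1 / 30 by decide +kernel]
  norm_num

theorem qExpansion_E₆_coeff (m : ℕ) : (qExpansion 1 E₆).coeff m =
    if m = 0 then 1 else -504 * (ArithmeticFunction.sigma 5 m : ℂ) := by
  rw [E_qExpansion_coeff _ ⟨3, rfl⟩, show bernoulli 6 = 1 / 42 by decide +kernel]
  norm_num

/-- A level one modular form of weight 12 is determined by its first two coefficients. -/
theorem ModularForm.qExpansion_eq_of_weight_twelve (f : ModularForm 𝒮ℒ 12) :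
    qExpansion 1 f = (((qExpansion 1 f).coeff 1 + 1008 * (qExpansion 1 f).coeff 0) / 1728) •
        qExpansion 1 E₄ ^ 3 +
      ((720 * (qExpansion 1 f).coeff 0 - (qExpansion 1 f).coeff 1) / 1728) •
        qExpansion 1 E₆ ^ 2 := by
  set c₀ := (qExpansion 1 f).coeff 0
  set c₁ := (qExpansion 1 f).coeff 1
  let F₄ : ModularForm 𝒮ℒ 12 := mcast (by decide) (E₄.pow 3)
  let F₆ : ModularForm 𝒮ℒ 12 := mcast (by decide) (E₆.pow 2)
  let g : ModularForm 𝒮ℒ 12 :=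
    f - ((c₁ + 1008 * c₀) / 1728) • F₄ - ((720 * c₀ - c₁) / 1728) • F₆
  have hF₄ : qExpansion 1 F₄ = qExpansion 1 E₄ ^ 3 :=
    ModularForm.qExpansion_pow one_pos one_mem_strictPeriods_SL E₄ 3
  have hF₆ : qExpansion 1 F₆ = qExpansion 1 E₆ ^ 2 :=
    ModularForm.qExpansion_pow one_pos one_mem_strictPeriods_SL E₆ 2
  have hg : qExpansion 1 g = qExpansion 1 f -
      ((c₁ + 1008 * c₀) / 1728) • qExpansion 1 E₄ ^ 3 -
      ((720 * c₀ - c₁) / 1728) • qExpansion 1 E₆ ^ 2 := by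
    rw [← hF₄, ← hF₆, ← ModularForm.qExpansion_smul one_pos one_mem_strictPeriods_SL,
      ← ModularForm.qExpansion_smul one_pos one_mem_strictPeriods_SL]
    exact (ModularForm.qExpansion_sub one_pos one_mem_strictPeriods_SL
      (f - ((c₁ + 1008 * c₀) / 1728) • F₄) (((720 * c₀ - c₁) / 1728) • F₆)).trans
      (congrArg (· - _) (ModularForm.qExpansion_sub one_pos one_mem_strictPeriods_SL f
        (((c₁ + 1008 * c₀) / 1728) • F₄)))
  have hzero : g = 0 := by
    apply ModularForm.sturm_bound_levelOne
    refine lt_of_lt_of_le (b := ((2 : ℕ) : ℕ∞)) (Nat.cast_lt.mpr (by decide)) ?_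
    refine PowerSeries.nat_le_order _ _ fun i hi ↦ ?_
    rw [hg]
    interval_cases i
    · simp [pow_succ, PowerSeries.coeff_mul, -PowerSeries.coeff_zero_eq_constantCoeff,
        qExpansion_E₄_coeff, qExpansion_E₆_coeff]
      ring
    · simp [pow_succ, PowerSeries.coeff_mul, -PowerSeries.coeff_zero_eq_constantCoeff,
        Finset.Nat.antidiagonal_succ, qExpansion_E₄_coeff, qExpansion_E₆_coeff]
      ring
  rw [hzero, FunLike.coe_zero, qExpansion_zero] at hg
  linear_combination -hg

theorem ModularForm.qExpansion_coeff_of_weight_twelve (f : ModularForm 𝒮ℒ 12) :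
    (qExpansion 1 f).coeff 2 =
        196560 * (qExpansion 1 f).coeff 0 - 24 * (qExpansion 1 f).coeff 1 ∧
      (qExpansion 1 f).coeff 3 =
        16773120 * (qExpansion 1 f).coeff 0 + 252 * (qExpansion 1 f).coeff 1 ∧
      (qExpansion 1 f).coeff 4 =
        398034000 * (qExpansion 1 f).coeff 0 - 1472 * (qExpansion 1 f).coeff 1 := by
  have hσ : ArithmeticFunction.sigma 3 2 = 9 ∧ ArithmeticFunction.sigma 3 3 = 28 ∧
      ArithmeticFunction.sigma 3 4 = 73 ∧ ArithmeticFunction.sigma 5 2 = 33 ∧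
      ArithmeticFunction.sigma 5 3 = 244 ∧ ArithmeticFunction.sigma 5 4 = 1057 := by
    decide +kernel
  obtain ⟨h1, h2, h3, h4, h5, h6⟩ := hσ
  have h := f.qExpansion_eq_of_weight_twelve
  set c₀ := (qExpansion 1 f).coeff 0
  set c₁ := (qExpansion 1 f).coeff 1
  rw [h]
  refine ⟨?_, ?_, ?_⟩ <;>
  · simp [pow_succ, PowerSeries.coeff_mul, -PowerSeries.coeff_zero_eq_constantCoeff,
      Finset.Nat.antidiagonal_succ, qExpansion_E₄_coeff, qExpansion_E₆_coeff, h1, h2, h3, h4, h5,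
      h6]
    ring

end WeightTwelve

section Gram

variable {ι L : Type*} [Fintype ι] [DecidableEq ι] [AddCommGroup L] [Module ℤ L]
  (b : Module.Basis ι ℤ L) (B : L →ₗ[ℤ] L →ₗ[ℤ] ℤ)

theorem toMatrix₂_dotProduct_mulVec (v : ι → ℤ) :
    v ⬝ᵥ LinearMap.toMatrix₂ b b B *ᵥ v = B (b.equivFun.symm v) (b.equivFun.symm v) :=
  dotProduct_toMatrix₂_mulVec b b B v v

theorem isSymm_toMatrix₂ (hsymm : ∀ x y : L, B x y = B y x) :
    (LinearMap.toMatrix₂ b b B).IsSymm := by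
  ext i j
  simp [LinearMap.toMatrix₂_apply, hsymm (b j)]

theorem isUnit_det_toMatrix₂ (hunimodular : Function.Surjective fun x : L ↦ B x)
    (hsymm : ∀ x y : L, B x y = B y x) : IsUnit (LinearMap.toMatrix₂ b b B).det := by
  rw [← Matrix.isUnit_iff_isUnit_det, ← Matrix.mulVec_surjective_iff_isUnit]
  intro w
  obtain ⟨x, hx⟩ := hunimodular (b.constr ℤ w)
  refine ⟨b.equivFun x, funext fun i ↦ ?_⟩
  have h : B (b i) x = w i := by
    rw [hsymm]
    exact (DFunLike.congr_fun hx (b i)).trans (b.constr_basis ℤ w i)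
  rw [← h]
  conv_rhs => rw [← b.sum_equivFun x]
  simp [-Module.Basis.sum_repr, Matrix.mulVec, dotProduct, LinearMap.toMatrix₂_apply, mul_comm]

end Gram

/-- For any Niemeier lattice `L` (even positive definite unimodular
lattice of rank 24), with `a i` the number of vectors of norm `i`, the identities
`a_4 = 196560 - 24·a_2`, `a_6 = 16773120 + 252·a_2`, and
`a_8 = 398034000 - 1472·a_2` hold. -/
theorem niemeier_theta_coeffs
    {L : Type*} [AddCommGroup L] [Module ℤ L] [Module.Free ℤ L] [Module.Finite ℤ L]
    (B : L →ₗ[ℤ] L →ₗ[ℤ] ℤ)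
    (hsymm : ∀ x y : L, B x y = B y x)
    (hposdef : ∀ x : L, x ≠ 0 → 0 < B x x)
    (hunimodular : Function.Bijective fun x : L => B x)
    (heven : ∀ x : L, Even (B x x))
    (hrank : Module.finrank ℤ L = 24)
    (a : ℤ → ℕ) (ha : ∀ i, a i = Nat.card {x : L | B x x = i}) :
    (a 4 : ℤ) = 196560 - 24 * (a 2 : ℤ) ∧
    (a 6 : ℤ) = 16773120 + 252 * (a 2 : ℤ) ∧
    (a 8 : ℤ) = 398034000 - 1472 * (a 2 : ℤ) := by
  let b := Module.finBasisOfFinrankEq ℤ L hrank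
  set G := LinearMap.toMatrix₂ b b B
  have hQ (v : Fin 24 → ℤ) : v ⬝ᵥ G *ᵥ v = B (b.equivFun.symm v) (b.equivFun.symm v) :=
    toMatrix₂_dotProduct_mulVec b B v
  have hnonneg (x : L) : 0 ≤ B x x := by
    rcases eq_or_ne x 0 with rfl | hx
    · simp
    · exact (hposdef x hx).le
  have hG : G.IsSymm := isSymm_toMatrix₂ b B hsymm
  have hpos (v : Fin 24 → ℤ) : 0 ≤ v ⬝ᵥ G *ᵥ v := (hQ v).symm ▸ hnonneg _
  have hunit : IsUnit G.det := isUnit_det_toMatrix₂ b B hunimodular.surjective hsymm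
  have heven' (v : Fin 24 → ℤ) : Even (v ⬝ᵥ G *ᵥ v) := (hQ v).symm ▸ heven _
  obtain ⟨f, hf⟩ :=
    exists_modularForm_eq_latticeTheta hG hpos hunit heven' (Fintype.card_fin 24)
  have hcard (m : ℕ) : Nat.card {v : Fin 24 → ℤ | v ⬝ᵥ G *ᵥ v = 2 * m} = a (2 * m) := by
    rw [ha]
    exact Nat.card_congr (b.equivFun.symm.toEquiv.subtypeEquiv fun v ↦ by
      simp [hQ])
  have hcoeff (m : ℕ) : (a (2 * m) : ℂ) = (UpperHalfPlane.qExpansion 1 f).coeff m := by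
    refine ModularFormClass.qExpansion_coeff_unique one_pos
      one_mem_strictPeriods_SL (c := fun m : ℕ ↦ (a (2 * m) : ℂ))
      (fun τ ↦ ?_) m
    simpa only [hf, hcard] using hasSum_latticeTheta hG hpos hunit heven' τ.im_pos
  have ha0 : a 0 = 1 := by
    have : {x : L | B x x = 0} = {0} := by
      ext x
      simp only [Set.mem_ofPred, Set.mem_singleton_iff]
      exact ⟨fun h ↦ by_contra fun hx ↦ (hposdef x hx).ne' h, fun h ↦ by simp [h]⟩
    rw [ha, this]
    simp
  have key := f.qExpansion_coeff_of_weight_twelve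
  simp only [← hcoeff, Nat.cast_ofNat, Nat.cast_zero, Nat.cast_one, mul_zero, mul_one, ha0]
    at key
  norm_num at key
  obtain ⟨h4, h6, h8⟩ := key
  refine ⟨?_, ?_, ?_⟩ <;> apply Int.cast_injective (α := ℂ) <;> push_cast <;> assumption
end
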